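/- The quotient right ℤ[F]-module C¹ / B¹ (which computes the first Čech cohomology of the decomposition space D with integer coefficients) is finitely presented. -/

import Mathlib

open scoped BigOperators

namespace DecompPaper

variable (B : Type) [DecidableEq B]

/-- The set of letters `B ⊔ B⁻¹` carries the discrete topology. -/
instance : TopologicalSpace (B × Bool) := ⊥

/-- The Gromov boundary `∂F` of the free group on `B`: the space of infinite reduced
words, i.e. sequences of letters with no cancelling adjacent pair, topologized as a
subspace of the product of discrete spaces. -/
abbrev Boundary : Type :=
  {s : ℕ → B × Bool // ∀ k, s (k + 1) ≠ ((s k).1, !(s k).2)}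

/-- The prefix of length `m` of an infinite reduced word, as an element of the free group. -/
def prefixOf (ξ : Boundary B) (m : ℕ) : FreeGroup B :=
  FreeGroup.mk (List.ofFn fun i : Fin m => ξ.1 i)

/-- Adjacency in the Cayley graph `T` of the free group with respect to `B`. -/
def Adj (g h : FreeGroup B) : Prop :=
  ∃ x : B × Bool, h = g * FreeGroup.mk [x]

/-- A set of vertices of `T` is a subtree iff any two of its vertices are joined by a
path in the Cayley graph staying inside the set. -/
def IsSubtree (X : Set (FreeGroup B)) : Prop :=
  ∀ g ∈ X, ∀ h ∈ X, Relation.ReflTransGen (fun a b => Adj B a b ∧ b ∈ X) g h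

/-- `C` is a connected component of `T ∖ X`. -/
def IsComponentOf (X C : Set (FreeGroup B)) : Prop :=
  ∃ v, v ∉ X ∧
    C = {u | Relation.ReflTransGen (fun a b => Adj B a b ∧ a ∉ X ∧ b ∉ X) v u}

/-- `∂C`: the set of boundary points all of whose sufficiently long prefixes lie in `C`. -/
def boundaryOf (C : Set (FreeGroup B)) : Set (Boundary B) :=
  {ξ | ∃ m, ∀ k, m ≤ k → prefixOf B ξ k ∈ C}

/-- The sequence `a` of group elements converges to the boundary point `ξ`:
every prefix of `ξ` is eventually an initial segment of the reduced word of `a k`. -/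
def TendstoBoundary (a : ℕ → FreeGroup B) (ξ : Boundary B) : Prop :=
  ∀ m : ℕ, ∃ K, ∀ k, K ≤ k → (List.ofFn fun i : Fin m => ξ.1 i) <+: (a k).toWord

/-- `{ξ, η}` is a line of the line pattern generated by the words `w i`: for some
`g` and `i`, `ξ` and `η` are the limits of `g * (w i) ^ k` as `k → +∞` and `k → -∞`
(in one of the two orders). -/
def IsLine {r : ℕ} (w : Fin r → FreeGroup B) (ξ η : Boundary B) : Prop :=
  ∃ (g : FreeGroup B) (i : Fin r),
    (TendstoBoundary B (fun k => g * w i ^ k) ξ ∧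
       TendstoBoundary B (fun k => g * (w i)⁻¹ ^ k) η) ∨
    (TendstoBoundary B (fun k => g * w i ^ k) η ∧
       TendstoBoundary B (fun k => g * (w i)⁻¹ ^ k) ξ)

/-- Malnormality of the family of cyclic subgroups `⟨w i⟩`. -/
def Malnormal {r : ℕ} (w : Fin r → FreeGroup B) : Prop :=
  ∀ (g : FreeGroup B) (i j : Fin r),
    (∃ x : FreeGroup B, x ∈ Subgroup.zpowers (w i) ∧ x ≠ 1 ∧
        g * x * g⁻¹ ∈ Subgroup.zpowers (w j)) →
      i = j ∧ g ∈ Subgroup.zpowers (w i)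

/-- The decomposition space `D`: the quotient of `∂F` by the smallest equivalence
relation identifying the two endpoints of each line, with the quotient topology. -/
abbrev DSpace {r : ℕ} (w : Fin r → FreeGroup B) : Type :=
  Quot (IsLine B w)

/-- The quotient projection `q : ∂F → D`. -/
def qmap {r : ℕ} (w : Fin r → FreeGroup B) : Boundary B → DSpace B w :=
  Quot.mk _

/-- The geodesic of the line with endpoints `ξ` and `η`: all prefixes of `ξ` or of `η`
of length at least the length of their longest common initial segment. -/
def lineGeodesic (ξ η : Boundary B) : Set (FreeGroup B) :=
  {g | ∃ k : ℕ, (g = prefixOf B ξ k ∨ g = prefixOf B η k) ∧ ∃ i ≤ k, ξ.1 i ≠ η.1 i}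

/-- The line with endpoints `ξ, η` passes through the subtree `X`. -/
def PassesThrough (ξ η : Boundary B) (X : Set (FreeGroup B)) : Prop :=
  ∃ g ∈ X, g ∈ lineGeodesic B ξ η

/-- A function `σ : D → ℤ` is supported on the subtree `X` if `σ ∘ q` is constant on
`∂C` for every connected component `C` of `T ∖ X`. -/
def SupportedOn {r : ℕ} (w : Fin r → FreeGroup B) (σ : DSpace B w → ℤ)
    (X : Set (FreeGroup B)) : Prop :=
  ∀ C : Set (FreeGroup B), IsComponentOf B X C →
    ∀ ξ, ξ ∈ boundaryOf B C → ∀ η, η ∈ boundaryOf B C →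
      σ (qmap B w ξ) = σ (qmap B w η)

/-- Prepending a letter to an infinite reduced word, cancelling if necessary. -/
def consB (x : B × Bool) (ξ : Boundary B) : Boundary B :=
  if h : ξ.1 0 = (x.1, !x.2) then
    ⟨fun k => ξ.1 (k + 1), fun k => ξ.2 (k + 1)⟩
  else
    ⟨fun k => Nat.rec x (fun j _ => ξ.1 j) k, by
      intro k
      cases k with
      | zero => exact h
      | succ j => exact ξ.2 j⟩

/-- The action of the free group on its boundary: left multiplication followed by
reduction. -/
def actB (g : FreeGroup B) (ξ : Boundary B) : Boundary B :=
  g.toWord.foldr (consB B) ξ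

/-- The induced action of the free group on the decomposition space. -/
noncomputable def actD {r : ℕ} (w : Fin r → FreeGroup B) (g : FreeGroup B)
    (x : DSpace B w) : DSpace B w :=
  qmap B w (actB B g (Quot.out x))

/-- The map `p : (ℤ[F])^k → C(D, ℤ)` of right `ℤ[F]`-modules determined by generators
`σ j`, where an element of the free module `(ℤ[F])^k` is recorded as a finitely
supported function `(Fin k × F) →₀ ℤ` and `e_j · g` is sent to `σ j · g`. -/
noncomputable def pMap {r : ℕ} (w : Fin r → FreeGroup B) {k : ℕ}
    (σ : Fin k → DSpace B w → ℤ) (x : (Fin k × FreeGroup B) →₀ ℤ) :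
    DSpace B w → ℤ :=
  fun d => x.sum fun p n => n * σ p.1 (actD B w p.2 d)

/-- Right translation by `g` on the free module `(ℤ[F])^k`, sending `e_j · h` to
`e_j · (h * g)`. -/
noncomputable def fsTranslate {k : ℕ} (y : (Fin k × FreeGroup B) →₀ ℤ)
    (g : FreeGroup B) : (Fin k × FreeGroup B) →₀ ℤ :=
  Finsupp.mapDomain (fun p => (p.1, p.2 * g)) y

/-- The convex hull of a set of vertices of `T`: the smallest subtree containing it. -/
def hull (S : Set (FreeGroup B)) : Set (FreeGroup B) :=
  ⋂₀ {Y : Set (FreeGroup B) | IsSubtree B Y ∧ S ⊆ Y}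

/-- The support of an element of the free module `(ℤ[F])^k`, relative to supports
`X j` of the generators: the convex hull of the union of the sets `g⁻¹ • X j` over
the pairs `(j, g)` appearing with nonzero coefficient. -/
def fsSupport {k : ℕ} (X : Fin k → Set (FreeGroup B))
    (x : (Fin k × FreeGroup B) →₀ ℤ) : Set (FreeGroup B) :=
  hull B (⋃ p ∈ x.support, (fun v => p.2⁻¹ * v) '' X p.1)

/-- Antisymmetry of a `1`-cochain on oriented lines. -/
def Antisym {r : ℕ} (w : Fin r → FreeGroup B)
    (f : Boundary B → Boundary B → ℤ) : Prop :=
  ∀ ξ η, IsLine B w ξ η → f η ξ = -f ξ η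

/-- A `1`-cochain is supported on the subtree `X`: it vanishes on lines not passing
through `X`, and depends only on the pair of components of `T ∖ X` containing the two
endpoints. -/
def SupportedOn1 {r : ℕ} (w : Fin r → FreeGroup B)
    (f : Boundary B → Boundary B → ℤ) (X : Set (FreeGroup B)) : Prop :=
  (∀ ξ η, IsLine B w ξ η → ¬PassesThrough B ξ η X → f ξ η = 0) ∧
  (∀ C C' : Set (FreeGroup B), IsComponentOf B X C → IsComponentOf B X C' → C ≠ C' →
    ∀ ξ ξ' η η', IsLine B w ξ η → IsLine B w ξ' η' →
      ξ ∈ boundaryOf B C → ξ' ∈ boundaryOf B C →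
      η ∈ boundaryOf B C' → η' ∈ boundaryOf B C' →
      f ξ η = f ξ' η')

/-- Membership in `C¹`: an antisymmetric integer-valued function on oriented lines
supported on at least one finite nonempty subtree of `T`. -/
def MemC1 {r : ℕ} (w : Fin r → FreeGroup B)
    (f : Boundary B → Boundary B → ℤ) : Prop :=
  Antisym B w f ∧
    ∃ X : Set (FreeGroup B), X.Finite ∧ X.Nonempty ∧ IsSubtree B X ∧
      SupportedOn1 B w f X

/-- The ball of radius `R` about a set `Y` of vertices of `T` (word metric). -/
def ballAbout (Y : Set (FreeGroup B)) (R : ℕ) : Set (FreeGroup B) :=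
  {g | ∃ y ∈ Y, (y⁻¹ * g).toWord.length ≤ R}

/-- The map `p : (ℤ[F])^k → C¹` of right `ℤ[F]`-modules determined by generators
`f j`, sending `e_j · g` to `f j · g`. -/
noncomputable def pC1 {k : ℕ} (f : Fin k → Boundary B → Boundary B → ℤ)
    (x : (Fin k × FreeGroup B) →₀ ℤ) : Boundary B → Boundary B → ℤ :=
  fun ξ η => x.sum fun p n => n * f p.1 (actB B p.2 ξ) (actB B p.2 η)

/-- `σ : ∂F → ℤ` is constant on `∂C` for every connected component `C` of `T ∖ X`. -/
def ConstOnComponents (X : Set (FreeGroup B)) (σ : Boundary B → ℤ) : Prop :=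
  ∀ C : Set (FreeGroup B), IsComponentOf B X C →
    ∀ ξ, ξ ∈ boundaryOf B C → ∀ η, η ∈ boundaryOf B C → σ ξ = σ η

/-- The shadow `S(g) ⊆ ∂F` of a nontrivial group element `g`: the boundary points
having the reduced word of `g` as an initial segment. -/
def shadow (g : FreeGroup B) : Set (Boundary B) :=
  {ξ | prefixOf B ξ g.toWord.length = g}

end DecompPaper

namespace DecompPaper

set_option linter.unusedSectionVars false

/-- The formal inverse of a letter. -/
def invLetter {B : Type} (x : B × Bool) : B × Bool := (x.1, !x.2)

@[simp]
lemma invLetter_invLetter {B : Type} (x : B × Bool) : invLetter (invLetter x) = x := by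
  simp [invLetter]

section BoundaryAction

variable {B : Type} [DecidableEq B]

/-- The word formed by the first `m` letters of a boundary point. -/
def initialWord (ξ : Boundary B) (m : ℕ) : List (B × Bool) :=
  List.ofFn fun i : Fin m => ξ.1 i

@[simp]
lemma length_initialWord (ξ : Boundary B) (m : ℕ) : (initialWord ξ m).length = m := by
  simp [initialWord]

@[simp]
lemma getElem_initialWord (ξ : Boundary B) (m i : ℕ) (h : i < (initialWord ξ m).length) :
    (initialWord ξ m)[i] = ξ.1 i := by
  simp [initialWord]

@[simp]
lemma initialWord_zero (ξ : Boundary B) : initialWord ξ 0 = [] := by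
  simp [initialWord]

lemma initialWord_succ (ξ : Boundary B) (m : ℕ) :
    initialWord ξ (m + 1) = initialWord ξ m ++ [ξ.1 m] := by
  rw [initialWord, List.ofFn_succ', List.concat_eq_append]
  rfl

lemma initialWord_isPrefix (ξ : Boundary B) {m n : ℕ} (h : m ≤ n) :
    initialWord ξ m <+: initialWord ξ n := by
  induction n, h using Nat.le_induction with
  | base => exact List.prefix_rfl
  | succ n _ ih => exact ih.trans (initialWord_succ ξ n ▸ List.prefix_append _ _)

lemma initialWord_eq_iff (ξ η : Boundary B) (m : ℕ) :
    initialWord ξ m = initialWord η m ↔ ∀ i < m, ξ.1 i = η.1 i := by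
  constructor
  · intro h i hi
    have := congrArg (fun L => L[i]?) h
    simpa [hi] using this
  · intro h
    exact List.ext_getElem (by simp) fun i h1 h2 => by simpa using h i (by simpa using h1)

lemma invLetter_ne_iff (x y : B × Bool) : y ≠ invLetter x ↔ (x.1 = y.1 → x.2 = y.2) := by
  obtain ⟨a, b⟩ := x
  obtain ⟨c, d⟩ := y
  cases b <;> cases d <;> simp [invLetter, eq_comm]

lemma isReduced_initialWord (ξ : Boundary B) (m : ℕ) :
    FreeGroup.IsReduced (initialWord ξ m) := by
  rw [FreeGroup.IsReduced, List.isChain_iff_getElem]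
  intro i hi
  simpa using (invLetter_ne_iff _ _).1 (ξ.2 i)

lemma prefixOf_eq (ξ : Boundary B) (m : ℕ) :
    prefixOf B ξ m = FreeGroup.mk (initialWord ξ m) := rfl

@[simp]
lemma toWord_prefixOf (ξ : Boundary B) (m : ℕ) :
    (prefixOf B ξ m).toWord = initialWord ξ m := by
  rw [prefixOf_eq, FreeGroup.toWord_mk, (isReduced_initialWord ξ m).reduce_eq]

@[simp]
lemma prefixOf_zero (ξ : Boundary B) : prefixOf B ξ 0 = 1 := by
  simp [prefixOf_eq, FreeGroup.one_eq_mk]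

lemma prefixOf_succ (ξ : Boundary B) (m : ℕ) :
    prefixOf B ξ (m + 1) = prefixOf B ξ m * FreeGroup.mk [ξ.1 m] := by
  simp [prefixOf_eq, initialWord_succ]

lemma prefixOf_injective (ξ : Boundary B) : Function.Injective (prefixOf B ξ) := by
  intro m n h
  simpa using congrArg (fun g => g.toWord.length) h

lemma consB_apply_of_eq {x : B × Bool} {ξ : Boundary B} (h : ξ.1 0 = invLetter x) (k : ℕ) :
    (consB B x ξ).1 k = ξ.1 (k + 1) := by
  rw [consB, dif_pos (by simpa [invLetter] using h)]

lemma consB_apply_zero {x : B × Bool} {ξ : Boundary B} (h : ξ.1 0 ≠ invLetter x) :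
    (consB B x ξ).1 0 = x := by
  rw [consB, dif_neg (by simpa [invLetter] using h)]
  rfl

lemma consB_apply_succ {x : B × Bool} {ξ : Boundary B} (h : ξ.1 0 ≠ invLetter x) (k : ℕ) :
    (consB B x ξ).1 (k + 1) = ξ.1 k := by
  rw [consB, dif_neg (by simpa [invLetter] using h)]

lemma consB_invLetter_consB (x : B × Bool) (ξ : Boundary B) :
    consB B (invLetter x) (consB B x ξ) = ξ := by
  apply Subtype.ext
  funext k
  by_cases h : ξ.1 0 = invLetter x
  · have h' : (consB B x ξ).1 0 ≠ invLetter (invLetter x) := by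
      rw [consB_apply_of_eq h, zero_add]
      have := ξ.2 0
      rwa [h] at this
    cases k with
    | zero => rw [consB_apply_zero h', h]
    | succ k => rw [consB_apply_succ h', consB_apply_of_eq h]
  · rw [consB_apply_of_eq (by simp [consB_apply_zero h]), consB_apply_succ h]

/-- The action of the free group on its boundary as a homomorphism to permutations. -/
def boundaryHom : FreeGroup B →* Equiv.Perm (Boundary B) :=
  FreeGroup.lift fun b =>
    { toFun := consB B (b, true)
      invFun := consB B (b, false)
      left_inv := consB_invLetter_consB (b, true)
      right_inv := consB_invLetter_consB (b, false) }

lemma boundaryHom_mk (L : List (B × Bool)) (ξ : Boundary B) :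
    boundaryHom (FreeGroup.mk L) ξ = L.foldr (consB B) ξ := by
  induction L with
  | nil => simp [boundaryHom, FreeGroup.lift_mk]
  | cons x L ih =>
    rw [List.foldr_cons, ← ih, boundaryHom, FreeGroup.lift_mk, FreeGroup.lift_mk, List.map_cons,
      List.prod_cons, Equiv.Perm.mul_apply]
    obtain ⟨b, _ | _⟩ := x <;> rfl

lemma actB_eq (g : FreeGroup B) (ξ : Boundary B) : actB B g ξ = boundaryHom g ξ := by
  rw [actB, ← boundaryHom_mk, FreeGroup.mk_toWord]

@[simp]
lemma actB_one (ξ : Boundary B) : actB B 1 ξ = ξ := by simp [actB_eq]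

lemma actB_mul (g h : FreeGroup B) (ξ : Boundary B) :
    actB B (g * h) ξ = actB B g (actB B h ξ) := by simp [actB_eq]

@[simp]
lemma actB_inv_actB (g : FreeGroup B) (ξ : Boundary B) : actB B g⁻¹ (actB B g ξ) = ξ := by
  rw [← actB_mul, inv_mul_cancel, actB_one]

lemma actB_letter (x : B × Bool) (ξ : Boundary B) :
    actB B (FreeGroup.mk [x]) ξ = consB B x ξ := by
  rw [actB_eq, boundaryHom_mk, List.foldr_cons, List.foldr_nil]

lemma actB_eq_of_mem_zpowers {u g : FreeGroup B} {ξ : Boundary B} (h : actB B u ξ = ξ)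
    (hg : g ∈ Subgroup.zpowers u) : actB B g ξ = ξ := by
  have : Subgroup.zpowers u ≤ (MulAction.stabilizer (Equiv.Perm (Boundary B)) ξ).comap
      boundaryHom := by
    rw [Subgroup.zpowers_le]
    simpa [actB_eq] using h
  simpa [actB_eq] using this hg

/-- Left multiplication by letters is an induction principle for the free group. -/
lemma letter_induction {p : FreeGroup B → Prop} (one : p 1)
    (letter_mul : ∀ x g, p g → p (FreeGroup.mk [x] * g)) (g : FreeGroup B) : p g := by
  rw [← FreeGroup.mk_toWord (x := g)]
  induction g.toWord with
  | nil => exact one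
  | cons x L ih => simpa using letter_mul x _ ih

lemma mk_cons (x : B × Bool) (L : List (B × Bool)) :
    FreeGroup.mk (x :: L) = FreeGroup.mk [x] * FreeGroup.mk L := by
  simp

lemma mk_invLetter (x : B × Bool) : FreeGroup.mk [invLetter x] = (FreeGroup.mk [x])⁻¹ := by
  simp [FreeGroup.inv_mk, FreeGroup.invRev, invLetter]

lemma initialWord_succ_of_eq {x : B × Bool} {ξ : Boundary B} (h : ξ.1 0 = invLetter x) (m : ℕ) :
    initialWord ξ (m + 1) = invLetter x :: initialWord (consB B x ξ) m := by
  simp only [initialWord, List.ofFn_succ, consB_apply_of_eq h]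
  simpa using h

lemma initialWord_consB_of_ne {x : B × Bool} {ξ : Boundary B} (h : ξ.1 0 ≠ invLetter x) (m : ℕ) :
    initialWord (consB B x ξ) (m + 1) = x :: initialWord ξ m := by
  simp [initialWord, List.ofFn_succ, consB_apply_succ h, consB_apply_zero h]

/-- Translation by `g` carries all long prefixes of `ξ` to long prefixes of `g • ξ`. -/
lemma exists_mul_prefixOf_eq (g : FreeGroup B) (ξ : Boundary B) (N : ℕ) :
    ∃ M, ∀ m, M ≤ m → ∃ n, N ≤ n ∧ g * prefixOf B ξ m = prefixOf B (actB B g ξ) n := by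
  induction g using letter_induction generalizing N with
  | one => exact ⟨N, fun m hm => ⟨m, hm, by simp⟩⟩
  | letter_mul x g ih =>
    obtain ⟨M, hM⟩ := ih (N + 1)
    refine ⟨M, fun m hm => ?_⟩
    obtain ⟨n, hn, h⟩ := hM m hm
    obtain ⟨n, rfl⟩ : ∃ n', n = n' + 1 := ⟨n - 1, by omega⟩
    rw [mul_assoc, h, actB_mul, actB_letter]
    by_cases h0 : (actB B g ξ).1 0 = invLetter x
    · refine ⟨n, by omega, ?_⟩
      rw [prefixOf_eq, initialWord_succ_of_eq h0, mk_cons (invLetter x), mk_invLetter,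
        mul_inv_cancel_left, prefixOf_eq]
    · refine ⟨n + 1 + 1, by omega, ?_⟩
      rw [prefixOf_eq, prefixOf_eq, initialWord_consB_of_ne h0, FreeGroup.mul_mk,
        List.singleton_append]

lemma actB_prefixOf_inv_apply (ξ : Boundary B) (m k : ℕ) :
    (actB B (prefixOf B ξ m)⁻¹ ξ).1 k = ξ.1 (m + k) := by
  induction m generalizing k with
  | zero => simp
  | succ m ih =>
    rw [prefixOf_succ, mul_inv_rev, ← mk_invLetter, actB_mul, actB_letter,
      consB_apply_of_eq (by simp [ih]), ih]
    grind

/-- Acting by a reduced word on `ξ` produces the first letter of that word, unless the whole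
word is cancelled. -/
lemma actB_apply_zero_or (ξ : Boundary B) (x : B × Bool) (L : List (B × Bool))
    (hL : FreeGroup.IsReduced (x :: L)) :
    (actB B (FreeGroup.mk (x :: L)) ξ).1 0 = x ∨
      (FreeGroup.mk (x :: L))⁻¹ = prefixOf B ξ (L.length + 1) := by
  have step : ∀ (x : B × Bool) (L : List (B × Bool)),
      (FreeGroup.mk L)⁻¹ = prefixOf B ξ L.length →
      (actB B (FreeGroup.mk (x :: L)) ξ).1 0 = x ∨
      (FreeGroup.mk (x :: L))⁻¹ = prefixOf B ξ (L.length + 1) := by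
    intro x L hL
    by_cases h : ξ.1 L.length = invLetter x
    · right
      rw [prefixOf_succ, h, mk_invLetter, mk_cons, mul_inv_rev, hL]
    · left
      rw [mk_cons, actB_mul, actB_letter, inv_eq_iff_eq_inv.1 hL, consB_apply_zero]
      rwa [actB_prefixOf_inv_apply, add_zero]
  induction L generalizing x with
  | nil => exact step x [] (by simp [← FreeGroup.one_eq_mk])
  | cons y L ih =>
    rw [FreeGroup.isReduced_cons_cons] at hL
    rcases ih y hL.2 with h | h
    · left
      rw [mk_cons, actB_mul, actB_letter, consB_apply_zero]
      rw [h]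
      exact (invLetter_ne_iff _ _).2 hL.1
    · exact step x _ h

lemma exists_inv_eq_prefixOf {g : FreeGroup B} {ξ η : Boundary B}
    (h : (actB B g ξ).1 0 ≠ (actB B g η).1 0) :
    ∃ m, g⁻¹ = prefixOf B ξ m ∨ g⁻¹ = prefixOf B η m := by
  have hred := FreeGroup.isReduced_toWord (x := g)
  rw [← FreeGroup.mk_toWord (x := g)] at h ⊢
  cases hg : g.toWord with
  | nil => exact ⟨0, by simp [← FreeGroup.one_eq_mk]⟩
  | cons x L =>
    rw [hg] at h hred
    rcases actB_apply_zero_or ξ x L hred with hξ | hξ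
    · rcases actB_apply_zero_or η x L hred with hη | hη
      · exact absurd (hξ.trans hη.symm) h
      · exact ⟨_, Or.inr hη⟩
    · exact ⟨_, Or.inl hξ⟩

lemma actB_prefixOf_inv_apply_zero_ne {ξ η : Boundary B} {k i : ℕ} (hik : i ≤ k)
    (hi : ξ.1 i ≠ η.1 i) :
    (actB B (prefixOf B ξ k)⁻¹ ξ).1 0 ≠ (actB B (prefixOf B ξ k)⁻¹ η).1 0 := by
  rw [actB_prefixOf_inv_apply, add_zero]
  cases k with
  | zero => simpa [Nat.le_zero.1 hik] using hi
  | succ k =>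
    have hword : (prefixOf B ξ (k + 1))⁻¹.toWord =
        invLetter (ξ.1 k) :: FreeGroup.invRev (initialWord ξ k) := by
      simp [FreeGroup.toWord_inv, initialWord_succ, FreeGroup.invRev, invLetter]
    have hmk : FreeGroup.mk (invLetter (ξ.1 k) :: FreeGroup.invRev (initialWord ξ k)) =
        (prefixOf B ξ (k + 1))⁻¹ := by
      rw [← hword, FreeGroup.mk_toWord]
    have := actB_apply_zero_or η (invLetter (ξ.1 k)) (FreeGroup.invRev (initialWord ξ k))
      (hword ▸ FreeGroup.isReduced_toWord)
    rw [hmk, inv_inv, FreeGroup.invRev_length, length_initialWord] at this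
    rcases this with h | h
    · rw [h]
      exact ξ.2 k
    · have hw : initialWord ξ (k + 1) = initialWord η (k + 1) := by
        simpa using congrArg FreeGroup.toWord h
      rw [initialWord_eq_iff] at hw
      rw [h, actB_prefixOf_inv_apply, add_zero]
      rcases hik.lt_or_eq with hlt | rfl
      · exact absurd (hw i hlt) hi
      · exact hi

/-- Translating a vertex of the geodesic of a line to the identity makes the endpoints of the
line differ in their first letter. -/
lemma apply_zero_ne_of_mem_lineGeodesic {ξ η : Boundary B} {g : FreeGroup B}
    (hg : g ∈ lineGeodesic B ξ η) : (actB B g⁻¹ ξ).1 0 ≠ (actB B g⁻¹ η).1 0 := by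
  obtain ⟨k, rfl | rfl, i, hik, hi⟩ := hg
  · exact actB_prefixOf_inv_apply_zero_ne hik hi
  · exact (actB_prefixOf_inv_apply_zero_ne hik hi.symm).symm

end BoundaryAction

section Limits

variable {B : Type} [DecidableEq B]

lemma tendstoBoundary_iff {a : ℕ → FreeGroup B} {ξ : Boundary B} :
    TendstoBoundary B a ξ ↔ ∀ m, ∃ K, ∀ k, K ≤ k → initialWord ξ m <+: (a k).toWord :=
  Iff.rfl

lemma TendstoBoundary.unique {a : ℕ → FreeGroup B} {ξ η : Boundary B}
    (hξ : TendstoBoundary B a ξ) (hη : TendstoBoundary B a η) : ξ = η := by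
  rw [tendstoBoundary_iff] at hξ hη
  apply Subtype.ext
  funext i
  obtain ⟨K, hK⟩ := hξ (i + 1)
  obtain ⟨K', hK'⟩ := hη (i + 1)
  have := List.prefix_of_prefix_length_le (hK _ (le_max_left K K')) (hK' _ (le_max_right K K'))
    (by simp)
  exact (initialWord_eq_iff ξ η (i + 1)).1 (this.eq_of_length (by simp)) i (by omega)

lemma TendstoBoundary.letter_mul {a : ℕ → FreeGroup B} {ξ : Boundary B}
    (h : TendstoBoundary B a ξ) (x : B × Bool) :
    TendstoBoundary B (fun k => FreeGroup.mk [x] * a k) (consB B x ξ) := by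
  rw [tendstoBoundary_iff] at h ⊢
  intro m
  obtain ⟨K, hK⟩ := h (m + 1)
  refine ⟨K, fun k hk => ?_⟩
  have hpre := hK k hk
  have hred : FreeGroup.IsReduced (a k).toWord := FreeGroup.isReduced_toWord
  by_cases h0 : ξ.1 0 = invLetter x
  · rw [initialWord_succ_of_eq h0] at hpre
    obtain ⟨t, ht⟩ := hpre
    rw [List.cons_append] at ht
    have : FreeGroup.mk [x] * a k = FreeGroup.mk (initialWord (consB B x ξ) m ++ t) := by
      rw [← FreeGroup.mk_toWord (x := a k), ← ht, mk_cons (invLetter x), mk_invLetter,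
        mul_inv_cancel_left]
    rw [this, FreeGroup.toWord_mk, FreeGroup.IsReduced.reduce_eq]
    · exact List.prefix_append _ _
    · exact hred.infix ⟨[invLetter x], [], by simpa using ht⟩
  · have hword : (FreeGroup.mk [x] * a k).toWord = x :: (a k).toWord := by
      rw [← FreeGroup.mk_toWord (x := a k), ← mk_cons, FreeGroup.toWord_mk, FreeGroup.toWord_mk,
        hred.reduce_eq, FreeGroup.IsReduced.reduce_eq]
      obtain ⟨t, ht⟩ := hpre
      rw [← List.singleton_append]
      rw [← ht] at hred ⊢
      simp only [initialWord, List.ofFn_succ, List.cons_append, List.nil_append] at hred ⊢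
      exact FreeGroup.isReduced_cons_cons.2 ⟨(invLetter_ne_iff _ _).1 h0, hred⟩
    rw [hword]
    refine (initialWord_isPrefix _ (Nat.le_succ m)).trans ?_
    rw [initialWord_consB_of_ne h0, List.cons_prefix_cons]
    exact ⟨rfl, (initialWord_isPrefix ξ (Nat.le_succ m)).trans hpre⟩

lemma TendstoBoundary.mul_left {a : ℕ → FreeGroup B} {ξ : Boundary B}
    (h : TendstoBoundary B a ξ) (g : FreeGroup B) :
    TendstoBoundary B (fun k => g * a k) (actB B g ξ) := by
  induction g using letter_induction with
  | one => simpa using h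
  | letter_mul x g ih =>
    simp only [mul_assoc, actB_mul, actB_letter]
    exact ih.letter_mul x

lemma actB_eq_of_tendstoBoundary_pow {u : FreeGroup B} {ξ : Boundary B}
    (h : TendstoBoundary B (fun k => u ^ k) ξ) : actB B u ξ = ξ := by
  refine (h.mul_left u).unique fun m => ?_
  obtain ⟨K, hK⟩ := h m
  refine ⟨K, fun k hk => ?_⟩
  simpa [pow_succ'] using hK (k + 1) (by omega)

/-- An increasing sequence of reduced words of unbounded length is the sequence of initial
segments of a boundary point. -/
lemma exists_boundary_of_chain (W : ℕ → List (B × Bool)) (hmono : ∀ n, W n <+: W (n + 1))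
    (hlen : ∀ n, n ≤ (W n).length) (hred : ∀ n, FreeGroup.IsReduced (W n)) :
    ∃ ξ : Boundary B, ∀ n, initialWord ξ n <+: W n := by
  have hle : ∀ {m n}, m ≤ n → W m <+: W n := by
    intro m n h
    induction n, h using Nat.le_induction with
    | base => exact List.prefix_rfl
    | succ n _ ih => exact ih.trans (hmono n)
  have hlt : ∀ k, k < (W (k + 1)).length := fun k => hlen (k + 1)
  have hget : ∀ n i (h : i < n), (W n)[i]'(h.trans_le (hlen n)) = (W (i + 1))[i]'(hlt i) :=
    fun n i h => ((hle (Nat.succ_le_of_lt h)).getElem (hlt i)).symm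
  refine ⟨⟨fun k => (W (k + 1))[k]'(hlt k), fun k => ?_⟩, fun n => ?_⟩
  · have h := hred (k + 2)
    rw [FreeGroup.IsReduced, List.isChain_iff_getElem] at h
    have h2 := h k (hlen (k + 2))
    rw [hget _ _ (by omega), hget _ _ (by omega)] at h2
    exact (invLetter_ne_iff _ _).2 h2
  · rw [List.prefix_iff_getElem]
    refine ⟨by simpa using hlen n, fun i hi => ?_⟩
    rw [getElem_initialWord]
    exact (hget n i (by simpa using hi)).symm

/-- The prefixes of `ξ` stay within bounded distance of the powers of `u`. -/
def Tracks (u : FreeGroup B) (ξ : Boundary B) : Prop :=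
  ∃ S : Set (FreeGroup B), S.Finite ∧ ∀ m, ∃ n : ℤ, ∃ s ∈ S, prefixOf B ξ m = u ^ n * s

lemma Tracks.of_inv {u : FreeGroup B} {ξ : Boundary B} (h : Tracks u⁻¹ ξ) : Tracks u ξ := by
  obtain ⟨S, hS, h⟩ := h
  refine ⟨S, hS, fun m => ?_⟩
  obtain ⟨n, s, hs, h⟩ := h m
  exact ⟨-n, s, hs, by simpa using h⟩

/-- If a translate of a point tracking the powers of `u` tracks the powers of `v`, then a
nontrivial power of `u` is conjugated to a power of `v`. -/
lemma Tracks.exists_conj_mem {u v h : FreeGroup B} {ξ : Boundary B} (hu : Tracks u ξ)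
    (hv : Tracks v (actB B h ξ)) :
    ∃ x ∈ Subgroup.zpowers u, x ≠ 1 ∧ h * x * h⁻¹ ∈ Subgroup.zpowers v := by
  obtain ⟨S, hS, hu⟩ := hu
  obtain ⟨S', hS', hv⟩ := hv
  obtain ⟨M, hM⟩ := exists_mul_prefixOf_eq h ξ 0
  have hv' : ∀ m, ∃ n : ℤ, ∃ s ∈ S', h * prefixOf B ξ (M + m) = v ^ n * s := by
    intro m
    obtain ⟨n, -, hn⟩ := hM (M + m) (by omega)
    rw [hn]
    exact hv n
  choose n s hs hns using fun m => hu (M + m)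
  choose n' s' hs' hns' using hv'
  have := hS.to_subtype
  have := hS'.to_subtype
  obtain ⟨a, b, hab, heq⟩ := Finite.exists_ne_map_eq_of_infinite
    (fun m : ℕ => ((⟨s m, hs m⟩, ⟨s' m, hs' m⟩) : S × S'))
  simp only [Prod.mk.injEq, Subtype.mk.injEq] at heq
  refine ⟨u ^ n a * (u ^ n b)⁻¹, mul_mem (zpow_mem (Subgroup.mem_zpowers u) _)
    (inv_mem (zpow_mem (Subgroup.mem_zpowers u) _)), fun h1 => ?_, ?_⟩
  · rw [mul_inv_eq_one] at h1
    refine hab ?_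
    have : prefixOf B ξ (M + a) = prefixOf B ξ (M + b) := by rw [hns, hns, h1, heq.1]
    simpa using prefixOf_injective ξ this
  · have : h * (u ^ n a * (u ^ n b)⁻¹) * h⁻¹ = v ^ n' a * (v ^ n' b)⁻¹ := by
      calc h * (u ^ n a * (u ^ n b)⁻¹) * h⁻¹
          = (h * (u ^ n a * s a)) * (h * (u ^ n b * s b))⁻¹ := by rw [heq.1]; group
        _ = v ^ n' a * (v ^ n' b)⁻¹ := by rw [← hns, ← hns, hns', hns', heq.2]; group
    rw [this]
    exact mul_mem (zpow_mem (Subgroup.mem_zpowers v) _)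
      (inv_mem (zpow_mem (Subgroup.mem_zpowers v) _))

/-- A prefix of `u cⁿ⁺¹ v` differs from a power of `u c u⁻¹` by a prefix of `u c v`. -/
lemma exists_mk_eq_pow_mul (u c v : List (B × Bool)) (n : ℕ) (p : List (B × Bool))
    (hp : p <+: u ++ (List.replicate (n + 1) c).flatten ++ v) :
    ∃ (j : ℕ) (s : List (B × Bool)), s <+: u ++ c ++ v ∧
      FreeGroup.mk p = FreeGroup.mk (u ++ c ++ FreeGroup.invRev u) ^ j * FreeGroup.mk s := by
  induction n generalizing p with
  | zero => exact ⟨0, p, by simpa using hp, by simp⟩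
  | succ n ih =>
    rw [List.replicate_succ, List.flatten_cons, ← List.append_assoc, List.append_assoc] at hp
    rcases List.prefix_or_prefix_of_prefix hp (List.prefix_append _ _) with hp' | ⟨q, rfl⟩
    · exact ⟨0, p, hp'.trans (List.prefix_append _ _), by simp⟩
    · obtain ⟨j, s, hs, h⟩ := ih (u ++ q) (by
        rw [List.append_assoc u, List.prefix_append_right_inj]
        exact (List.prefix_append_right_inj _).1 hp)
      refine ⟨j + 1, s, hs, ?_⟩
      rw [pow_succ', mul_assoc, ← h]
      simp only [← FreeGroup.mul_mk, ← FreeGroup.inv_mk]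
      group

lemma toWord_pow_succ (u : FreeGroup B) (n : ℕ) :
    (u ^ (n + 1)).toWord = FreeGroup.reduceCyclically.conjugator u.toWord ++
      (List.replicate (n + 1) (FreeGroup.reduceCyclically u.toWord)).flatten ++
      FreeGroup.invRev (FreeGroup.reduceCyclically.conjugator u.toWord) := by
  rw [FreeGroup.toWord_pow,
    FreeGroup.reduceCyclically.reduce_flatten_replicate_succ FreeGroup.isReduced_toWord]

lemma reduceCyclically_toWord_ne_nil {u : FreeGroup B} (hu : u ≠ 1) :
    FreeGroup.reduceCyclically u.toWord ≠ [] := by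
  intro h
  have := congrArg FreeGroup.mk
    (FreeGroup.reduceCyclically.conj_conjugator_reduceCyclically u.toWord)
  rw [h, FreeGroup.mk_toWord, List.append_nil, ← FreeGroup.mul_mk, ← FreeGroup.inv_mk,
    mul_inv_cancel] at this
  exact hu this.symm

lemma exists_tendstoBoundary_pow {u : FreeGroup B} (hu : u ≠ 1) :
    ∃ ξ, TendstoBoundary B (fun k => u ^ k) ξ := by
  obtain ⟨ξ, hξ⟩ := exists_boundary_of_chain
    (fun n => FreeGroup.reduceCyclically.conjugator u.toWord ++
      (List.replicate n (FreeGroup.reduceCyclically u.toWord)).flatten)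
    (fun n => by
      rw [List.replicate_succ', List.flatten_concat, ← List.append_assoc]
      exact List.prefix_append _ _)
    (fun n => by
      have : 1 ≤ (FreeGroup.reduceCyclically u.toWord).length :=
        List.length_pos_iff.2 (reduceCyclically_toWord_ne_nil hu)
      simp only [List.length_append, List.length_flatten, List.map_replicate, List.sum_replicate,
        smul_eq_mul]
      nlinarith)
    (fun n => by
      have h : FreeGroup.IsReduced (u ^ (n + 1)).toWord := FreeGroup.isReduced_toWord
      rw [toWord_pow_succ, List.replicate_succ', List.flatten_concat] at h
      refine h.infix (List.IsPrefix.isInfix ?_)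
      rw [← List.append_assoc, List.append_assoc _ _ (FreeGroup.invRev _)]
      exact List.prefix_append _ _)
  refine ⟨ξ, tendstoBoundary_iff.2 fun m => ⟨m + 1, fun k hk => ?_⟩⟩
  obtain ⟨k, rfl⟩ : ∃ k', k = k' + 1 := ⟨k - 1, by omega⟩
  rw [toWord_pow_succ]
  exact ((initialWord_isPrefix ξ (by omega : m ≤ k + 1)).trans (hξ (k + 1))).trans
    (List.prefix_append _ _)

lemma TendstoBoundary.tracks {u : FreeGroup B} {ξ : Boundary B}
    (h : TendstoBoundary B (fun k => u ^ k) ξ) : Tracks u ξ := by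
  refine ⟨FreeGroup.mk '' {s | s <+: u.toWord}, ?_, fun m => ?_⟩
  · refine Set.Finite.image _ (u.toWord.inits.toFinset.finite_toSet.subset ?_)
    intro s hs
    simpa using hs
  · obtain ⟨K, hK⟩ := h m
    have hpre := hK (K + 1) (by omega)
    rw [toWord_pow_succ] at hpre
    obtain ⟨j, s, hs, heq⟩ := exists_mk_eq_pow_mul _ _ _ _ _ hpre
    rw [FreeGroup.reduceCyclically.conj_conjugator_reduceCyclically] at hs heq
    rw [FreeGroup.mk_toWord] at heq
    exact ⟨j, _, ⟨s, hs, rfl⟩, by simpa [prefixOf] using heq⟩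

lemma tendstoBoundary_pow_ne_inv {u : FreeGroup B} (hu : u ≠ 1) {ξ η : Boundary B}
    (hξ : TendstoBoundary B (fun k => u ^ k) ξ)
    (hη : TendstoBoundary B (fun k => u⁻¹ ^ k) η) : ξ ≠ η := by
  rintro rfl
  rw [tendstoBoundary_iff] at hξ hη
  set c := FreeGroup.reduceCyclically.conjugator u.toWord with hc
  obtain ⟨K, hK⟩ := hξ (c.length + 1)
  obtain ⟨K', hK'⟩ := hη (c.length + 1)
  have h1 := hK (max K K' + 1) (by omega)
  have h2 := hK' (max K K' + 1) (by omega)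
  rw [inv_pow, FreeGroup.toWord_inv] at h2
  rw [toWord_pow_succ] at h1 h2
  have hcyc := (FreeGroup.reduceCyclically.isCyclicallyReduced
    (FreeGroup.isReduced_toWord (x := u))).flatten_replicate (max K K' + 1)
  set C := (List.replicate (max K K' + 1) (FreeGroup.reduceCyclically u.toWord)).flatten with hC
  have hCne : C ≠ [] := by
    simp [hC, reduceCyclically_toWord_ne_nil hu]
  rw [← hc] at h1 h2
  have hpos : 0 < C.length := List.length_pos_iff.2 hCne
  have e1 : ξ.1 c.length = C.head hCne := by
    have := h1.getElem (i := c.length) (by simp)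
    simpa [List.getElem_append_left, List.getElem_append_right, hpos, List.head_eq_getElem]
      using this
  have e2 : ξ.1 c.length = invLetter (C.getLast hCne) := by
    have hrev : FreeGroup.invRev (c ++ C ++ FreeGroup.invRev c) =
        c ++ FreeGroup.invRev C ++ FreeGroup.invRev c := by
      simp [FreeGroup.invRev_append]
    rw [hrev] at h2
    have := h2.getElem (i := c.length) (by simp)
    simpa [List.getElem_append_left, List.getElem_append_right, hpos, List.getLast_eq_getElem,
      FreeGroup.invRev, invLetter] using this
  have h3 := hcyc.2 (C.getLast hCne) (List.getLast_mem_getLast? hCne) (C.head hCne)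
    (List.head_mem_head? hCne)
  exact (invLetter_ne_iff _ _).2 h3 (e1.symm.trans e2)

end Limits

section Ball

variable {B : Type} [DecidableEq B]

/-- The ball of radius `M` about the identity. -/
def ball (B : Type) [DecidableEq B] (M : ℕ) : Set (FreeGroup B) := {g | g.toWord.length ≤ M}

lemma finite_ball [Finite B] (M : ℕ) : (ball B M).Finite :=
  Set.Finite.preimage FreeGroup.toWord_injective.injOn (List.finite_length_le (B × Bool) M)

lemma one_mem_ball (M : ℕ) : (1 : FreeGroup B) ∈ ball B M := by simp [ball]

lemma mk_mem_ball {L : List (B × Bool)} {M : ℕ} (h : L.length ≤ M) :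
    FreeGroup.mk L ∈ ball B M :=
  (FreeGroup.norm_mk_le (L₁ := L)).trans h

lemma isSubtree_ball (M : ℕ) : IsSubtree B (ball B M) := by
  have key : ∀ L : List (B × Bool), L.length ≤ M →
      Relation.ReflTransGen (fun a b => Adj B a b ∧ b ∈ ball B M) 1 (FreeGroup.mk L) ∧
      Relation.ReflTransGen (fun a b => Adj B a b ∧ b ∈ ball B M) (FreeGroup.mk L) 1 := by
    intro L
    induction L using List.reverseRecOn with
    | nil => exact fun _ => ⟨Relation.ReflTransGen.refl, Relation.ReflTransGen.refl⟩
    | append_singleton L x ih =>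
      intro hL
      have hL' : L.length ≤ M := by simp at hL; omega
      refine ⟨(ih hL').1.tail ⟨⟨x, by simp⟩, mk_mem_ball hL⟩,
        Relation.ReflTransGen.head ⟨⟨invLetter x, ?_⟩, mk_mem_ball hL'⟩ (ih hL').2⟩
      rw [mk_invLetter, ← FreeGroup.mul_mk, mul_inv_cancel_right]
  intro g hg h hh
  have hg' := (key g.toWord hg).2
  have hh' := (key h.toWord hh).1
  rw [FreeGroup.mk_toWord] at hg' hh'
  exact hg'.trans hh'

lemma toWord_mul_letter_or (g : FreeGroup B) (x : B × Bool) :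
    (g * FreeGroup.mk [x]).toWord = g.toWord ++ [x] ∨
      g.toWord = (g * FreeGroup.mk [x]).toWord ++ [invLetter x] := by
  have hred : FreeGroup.IsReduced g.toWord := FreeGroup.isReduced_toWord
  have happ : g * FreeGroup.mk [x] = FreeGroup.mk (g.toWord ++ [x]) := by
    rw [← FreeGroup.mul_mk, FreeGroup.mk_toWord]
  rcases List.eq_nil_or_concat g.toWord with h | ⟨L, y, h⟩
  · left
    rw [happ, h, FreeGroup.toWord_mk]
    rfl
  · rw [List.concat_eq_append] at h
    by_cases hxy : y = invLetter x
    · right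
      have : g * FreeGroup.mk [x] = FreeGroup.mk L := by
        rw [happ, h, hxy, ← FreeGroup.mul_mk, ← FreeGroup.mul_mk, mk_invLetter,
          inv_mul_cancel_right]
      rw [this, h, FreeGroup.toWord_mk, FreeGroup.IsReduced.reduce_eq, hxy]
      exact (h ▸ hred).infix (List.prefix_append _ _).isInfix
    · left
      rw [happ, FreeGroup.toWord_mk, FreeGroup.IsReduced.reduce_eq]
      rw [h] at hred ⊢
      refine hred.append_overlap (L₃ := [x]) ?_ (by simp)
      refine FreeGroup.isReduced_cons_cons.2 ⟨(invLetter_ne_iff y x).1 ?_,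
        FreeGroup.IsReduced.singleton⟩
      rintro rfl
      simp at hxy

/-- The first `M + 1` letters are constant on each component of the complement of the ball of
radius `M`. -/
lemma initialWord_eq_of_mem_boundaryOf {M : ℕ} {C : Set (FreeGroup B)}
    (hC : IsComponentOf B (ball B M) C) {ξ η : Boundary B} (hξ : ξ ∈ boundaryOf B C)
    (hη : η ∈ boundaryOf B C) : initialWord ξ (M + 1) = initialWord η (M + 1) := by
  obtain ⟨v, -, rfl⟩ := hC
  have key : ∀ g, Relation.ReflTransGen
      (fun a b => Adj B a b ∧ a ∉ ball B M ∧ b ∉ ball B M) v g →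
      g.toWord.take (M + 1) = v.toWord.take (M + 1) := by
    intro g hg
    induction hg with
    | refl => rfl
    | tail _ hbc ih =>
      obtain ⟨⟨x, rfl⟩, ha, hb⟩ := hbc
      rw [← ih]
      simp only [ball, Set.mem_ofPred_eq, not_le] at ha hb
      rcases toWord_mul_letter_or _ x with h | h
      · rw [h, List.take_append_of_le_length ha]
      · rw [h, List.take_append_of_le_length hb]
  have point : ∀ ξ : Boundary B, ξ ∈ boundaryOf B {u | Relation.ReflTransGen
      (fun a b => Adj B a b ∧ a ∉ ball B M ∧ b ∉ ball B M) v u} →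
      initialWord ξ (M + 1) = v.toWord.take (M + 1) := by
    rintro ξ ⟨m, hm⟩
    rw [← key _ (hm (max m (M + 1)) (le_max_left _ _)), toWord_prefixOf]
    simpa using List.prefix_iff_eq_take.1 (initialWord_isPrefix ξ (le_max_right m (M + 1)))
  rw [point ξ hξ, point η hη]

end Ball

section Cochains

variable {B : Type} [DecidableEq B] {r : ℕ}

/-- The endpoints `w i ^ ±∞` of the lines stabilized by the words `w i`. -/
structure PatternEnds (w : Fin r → FreeGroup B) where
  /-- The attracting endpoint of `w i`. -/
  pos : Fin r → Boundary B
  /-- The repelling endpoint of `w i`. -/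
  neg : Fin r → Boundary B
  tendsto_pos : ∀ i, TendstoBoundary B (fun k => w i ^ k) (pos i)
  tendsto_neg : ∀ i, TendstoBoundary B (fun k => (w i)⁻¹ ^ k) (neg i)
  pos_ne_neg : ∀ i, pos i ≠ neg i

lemma nonempty_patternEnds {w : Fin r → FreeGroup B} (hw : ∀ i, w i ≠ 1) :
    Nonempty (PatternEnds w) := by
  choose P hP using fun i => exists_tendstoBoundary_pow (hw i)
  choose N hN using fun i => exists_tendstoBoundary_pow (inv_ne_one.2 (hw i))
  exact ⟨⟨P, N, hP, hN, fun i => tendstoBoundary_pow_ne_inv (hw i) (hP i) (hN i)⟩⟩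

/-- Two pairs `(i, g)` and `(j, h)` are equivalent if `i = j` and `⟨w i⟩ g = ⟨w i⟩ h`. -/
def cosetSetoid (w : Fin r → FreeGroup B) : Setoid (Fin r × FreeGroup B) where
  r a b := a.1 = b.1 ∧ b.2 * a.2⁻¹ ∈ Subgroup.zpowers (w a.1)
  iseqv :=
    { refl := fun a => ⟨rfl, by simp⟩
      symm := by
        rintro ⟨i, g⟩ ⟨j, h⟩ ⟨rfl, hm⟩
        exact ⟨rfl, by simpa using inv_mem hm⟩
      trans := by
        rintro ⟨i, g⟩ ⟨j, h⟩ ⟨k, l⟩ ⟨rfl, hm⟩ ⟨rfl, hn⟩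
        exact ⟨rfl, by simpa [mul_assoc] using mul_mem hn hm⟩ }

/-- The class of `(i, g)`, which determines the line `g⁻¹ {w i ^ +∞, w i ^ -∞}`. -/
def lineClass (w : Fin r → FreeGroup B) (a : Fin r × FreeGroup B) :
    Quotient (cosetSetoid w) := Quotient.mk _ a

lemma lineClass_eq_iff {w : Fin r → FreeGroup B} {i j : Fin r} {g h : FreeGroup B} :
    lineClass w (i, g) = lineClass w (j, h) ↔ i = j ∧ h * g⁻¹ ∈ Subgroup.zpowers (w i) :=
  Quotient.eq (r := cosetSetoid w)

lemma lineClass_out {w : Fin r → FreeGroup B} (q : Quotient (cosetSetoid w)) :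
    lineClass w q.out = q := Quotient.out_eq q

namespace PatternEnds

variable {w : Fin r → FreeGroup B} (E : PatternEnds w)

lemma actB_pos {i : Fin r} {g : FreeGroup B} (hg : g ∈ Subgroup.zpowers (w i)) :
    actB B g (E.pos i) = E.pos i :=
  actB_eq_of_mem_zpowers (actB_eq_of_tendstoBoundary_pow (E.tendsto_pos i)) hg

lemma actB_neg {i : Fin r} {g : FreeGroup B} (hg : g ∈ Subgroup.zpowers (w i)) :
    actB B g (E.neg i) = E.neg i :=
  actB_eq_of_mem_zpowers (actB_eq_of_tendstoBoundary_pow (E.tendsto_neg i))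
    (by rwa [Subgroup.zpowers_inv])

lemma tracks_pos (i : Fin r) : Tracks (w i) (E.pos i) := (E.tendsto_pos i).tracks

lemma tracks_neg (i : Fin r) : Tracks (w i) (E.neg i) := (E.tendsto_neg i).tracks.of_inv

/-- The positive endpoint of the line `g⁻¹ {w i ^ +∞, w i ^ -∞}`. -/
def posEnd (a : Fin r × FreeGroup B) : Boundary B := actB B a.2⁻¹ (E.pos a.1)

/-- The negative endpoint of the line `g⁻¹ {w i ^ +∞, w i ^ -∞}`. -/
def negEnd (a : Fin r × FreeGroup B) : Boundary B := actB B a.2⁻¹ (E.neg a.1)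

lemma isLine_iff {ξ η : Boundary B} :
    IsLine B w ξ η ↔ ∃ a, (ξ = E.posEnd a ∧ η = E.negEnd a) ∨
      (ξ = E.negEnd a ∧ η = E.posEnd a) := by
  have hpos : ∀ g i ζ, TendstoBoundary B (fun k => g * w i ^ k) ζ ↔ ζ = actB B g (E.pos i) :=
    fun g i ζ => ⟨fun h => h.unique ((E.tendsto_pos i).mul_left g),
      fun h => h ▸ (E.tendsto_pos i).mul_left g⟩
  have hneg : ∀ g i ζ, TendstoBoundary B (fun k => g * (w i)⁻¹ ^ k) ζ ↔
      ζ = actB B g (E.neg i) :=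
    fun g i ζ => ⟨fun h => h.unique ((E.tendsto_neg i).mul_left g),
      fun h => h ▸ (E.tendsto_neg i).mul_left g⟩
  simp only [IsLine, hpos, hneg, posEnd, negEnd]
  constructor
  · rintro ⟨g, i, h⟩
    refine ⟨(i, g⁻¹), ?_⟩
    rw [inv_inv]
    tauto
  · rintro ⟨⟨i, g⟩, h⟩
    exact ⟨g⁻¹, i, by tauto⟩

lemma isLine_posEnd_negEnd (a : Fin r × FreeGroup B) :
    IsLine B w (E.posEnd a) (E.negEnd a) :=
  E.isLine_iff.2 ⟨a, Or.inl ⟨rfl, rfl⟩⟩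

lemma posEnd_translate (g : FreeGroup B) (a : Fin r × FreeGroup B) :
    actB B g (E.posEnd a) = E.posEnd (a.1, a.2 * g⁻¹) := by
  simp [posEnd, actB_mul]

lemma negEnd_translate (g : FreeGroup B) (a : Fin r × FreeGroup B) :
    actB B g (E.negEnd a) = E.negEnd (a.1, a.2 * g⁻¹) := by
  simp [negEnd, actB_mul]

lemma isLine_actB (E : PatternEnds w) {ξ η : Boundary B} (h : IsLine B w ξ η) (g : FreeGroup B) :
    IsLine B w (actB B g ξ) (actB B g η) := by
  rw [E.isLine_iff] at h ⊢
  obtain ⟨a, ⟨rfl, rfl⟩ | ⟨rfl, rfl⟩⟩ := h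
  · exact ⟨(a.1, a.2 * g⁻¹), Or.inl ⟨E.posEnd_translate g a, E.negEnd_translate g a⟩⟩
  · exact ⟨(a.1, a.2 * g⁻¹), Or.inr ⟨E.negEnd_translate g a, E.posEnd_translate g a⟩⟩

lemma posEnd_eq_of_lineClass_eq {a b : Fin r × FreeGroup B}
    (h : lineClass w a = lineClass w b) : E.posEnd a = E.posEnd b := by
  obtain ⟨i, g⟩ := a
  obtain ⟨j, h'⟩ := b
  obtain ⟨rfl, hm⟩ := lineClass_eq_iff.1 h
  have := E.actB_pos hm
  simp only [posEnd]
  nth_rw 2 [← this]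
  simp [actB_mul]

lemma negEnd_eq_of_lineClass_eq {a b : Fin r × FreeGroup B}
    (h : lineClass w a = lineClass w b) : E.negEnd a = E.negEnd b := by
  obtain ⟨i, g⟩ := a
  obtain ⟨j, h'⟩ := b
  obtain ⟨rfl, hm⟩ := lineClass_eq_iff.1 h
  have := E.actB_neg hm
  simp only [negEnd]
  nth_rw 2 [← this]
  simp [actB_mul]

open Classical in
/-- The cochain taking the value `1` on the oriented line `(w j ^ +∞, w j ^ -∞)`, the value `-1`
on the opposite oriented line, and `0` elsewhere. -/
noncomputable def delta (j : Fin r) (ξ η : Boundary B) : ℤ :=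
  (if ξ = E.pos j ∧ η = E.neg j then 1 else 0) - (if ξ = E.neg j ∧ η = E.pos j then 1 else 0)

lemma delta_swap (j : Fin r) (ξ η : Boundary B) : E.delta j η ξ = -E.delta j ξ η := by
  classical
  rw [delta, delta, neg_sub]
  congr 1 <;> exact if_congr and_comm rfl rfl

open Classical in
lemma delta_actB (hmal : Malnormal B w) (a b : Fin r × FreeGroup B) :
    E.delta b.1 (actB B b.2 (E.posEnd a)) (actB B b.2 (E.negEnd a)) =
      if lineClass w b = lineClass w a then 1 else 0 := by
  obtain ⟨i, g⟩ := a
  obtain ⟨j, h⟩ := b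
  simp only [posEnd, negEnd, ← actB_mul, delta]
  have hpos : ∀ ζ, Tracks (w j) ζ → actB B (h * g⁻¹) (E.pos i) = ζ →
      i = j ∧ h * g⁻¹ ∈ Subgroup.zpowers (w i) :=
    fun ζ hζ he => hmal (h * g⁻¹) i j ((E.tracks_pos i).exists_conj_mem (he ▸ hζ))
  rw [if_neg (c := actB B (h * g⁻¹) (E.pos i) = E.neg j ∧ _), sub_zero]
  · refine if_congr ?_ rfl rfl
    rw [eq_comm (a := lineClass w (j, h)), lineClass_eq_iff]
    constructor
    · exact fun he => hpos _ (E.tracks_pos j) he.1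
    · rintro ⟨rfl, hm⟩
      exact ⟨E.actB_pos hm, E.actB_neg hm⟩
  · rintro ⟨he, -⟩
    obtain ⟨rfl, hm⟩ := hpos _ (E.tracks_neg j) he
    exact E.pos_ne_neg i ((E.actB_pos hm).symm.trans he)

lemma pC1_posEnd_negEnd (hmal : Malnormal B w) (x : (Fin r × FreeGroup B) →₀ ℤ)
    (a : Fin r × FreeGroup B) :
    pC1 B E.delta x (E.posEnd a) (E.negEnd a) = x.mapDomain (lineClass w) (lineClass w a) := by
  classical
  simp only [pC1, Finsupp.mapDomain, Finsupp.sum_apply, E.delta_actB hmal, Finsupp.single_apply,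
    mul_ite, mul_one, mul_zero]

lemma pC1_delta_swap (x : (Fin r × FreeGroup B) →₀ ℤ) (ξ η : Boundary B) :
    pC1 B E.delta x η ξ = -pC1 B E.delta x ξ η := by
  simp only [pC1, Finsupp.sum, E.delta_swap _ (actB B _ ξ), mul_neg, Finset.sum_neg_distrib]

/-- Antisymmetric cochains are determined by their values on positively oriented lines. -/
lemma eq_on_lines {f f' : Boundary B → Boundary B → ℤ} (hf : Antisym B w f)
    (hf' : Antisym B w f')
    (h : ∀ a, f (E.posEnd a) (E.negEnd a) = f' (E.posEnd a) (E.negEnd a)) {ξ η : Boundary B}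
    (hl : IsLine B w ξ η) : f ξ η = f' ξ η := by
  obtain ⟨a, ⟨rfl, rfl⟩ | ⟨rfl, rfl⟩⟩ := E.isLine_iff.1 hl
  · exact h a
  · rw [hf _ _ (E.isLine_posEnd_negEnd a), hf' _ _ (E.isLine_posEnd_negEnd a), h a]

lemma antisym_pC1_delta (x : (Fin r × FreeGroup B) →₀ ℤ) : Antisym B w (pC1 B E.delta x) :=
  fun ξ η _ => E.pC1_delta_swap x ξ η

lemma exists_eq_pC1_delta (hmal : Malnormal B w) {f : Boundary B → Boundary B → ℤ}
    (hf : Antisym B w f) {S : Set (Quotient (cosetSetoid w))} (hS : S.Finite)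
    (hfS : ∀ a, f (E.posEnd a) (E.negEnd a) ≠ 0 → lineClass w a ∈ S) :
    ∃ x : (Fin r × FreeGroup B) →₀ ℤ, ∀ ξ η, IsLine B w ξ η →
      f ξ η = pC1 B E.delta x ξ η := by
  let y : Quotient (cosetSetoid w) →₀ ℤ := Finsupp.onFinset hS.toFinset
    (fun q => f (E.posEnd q.out) (E.negEnd q.out))
    (fun q hq => by simpa [lineClass_out] using hfS _ hq)
  refine ⟨y.mapDomain Quotient.out, fun ξ η hl =>
    E.eq_on_lines hf (E.antisym_pC1_delta _) (fun a => ?_) hl⟩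
  have hid : lineClass w ∘ Quotient.out = id := funext lineClass_out
  have hout : lineClass w (lineClass w a).out = lineClass w a := lineClass_out _
  rw [E.pC1_posEnd_negEnd hmal, ← Finsupp.mapDomain_comp, hid, Finsupp.mapDomain_id]
  simp only [y, Finsupp.onFinset_apply]
  rw [E.posEnd_eq_of_lineClass_eq hout, E.negEnd_eq_of_lineClass_eq hout]

/-- Only finitely many lines pass through a given vertex. -/
lemma finite_lineClass_through (v : FreeGroup B) :
    {q | ∃ a, lineClass w a = q ∧
      (actB B v⁻¹ (E.posEnd a)).1 0 ≠ (actB B v⁻¹ (E.negEnd a)).1 0}.Finite := by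
  choose S hS hpos using E.tracks_pos
  choose S' hS' hneg using E.tracks_neg
  refine (Set.finite_iUnion fun i =>
    ((hS i).union (hS' i)).image fun s => lineClass w (i, s * v⁻¹)).subset ?_
  rintro q ⟨⟨i, g⟩, rfl, hne⟩
  simp only [posEnd, negEnd, ← actB_mul] at hne
  have key : ∀ (n : ℤ) (s : FreeGroup B), (v⁻¹ * g⁻¹)⁻¹ = w i ^ n * s →
      lineClass w (i, s * v⁻¹) = lineClass w (i, g) := by
    intro n s h
    rw [lineClass_eq_iff]
    refine ⟨rfl, n, ?_⟩
    have : g * v = w i ^ n * s := by simpa using h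
    simp only [mul_inv_rev, inv_inv]
    rw [← mul_assoc, this, mul_inv_cancel_right]
  rw [Set.mem_iUnion]
  obtain ⟨m, hm | hm⟩ := exists_inv_eq_prefixOf hne
  · obtain ⟨n, s, hs, h⟩ := hpos i m
    exact ⟨i, s, Or.inl hs, key n s (hm.trans h)⟩
  · obtain ⟨n, s, hs, h⟩ := hneg i m
    exact ⟨i, s, Or.inr hs, key n s (hm.trans h)⟩

lemma finite_lineClass_passesThrough {X : Set (FreeGroup B)} (hX : X.Finite) :
    {q | ∃ a, lineClass w a = q ∧ PassesThrough B (E.posEnd a) (E.negEnd a) X}.Finite := by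
  refine (hX.biUnion fun v _ => E.finite_lineClass_through v).subset ?_
  rintro q ⟨a, rfl, v, hv, hg⟩
  exact Set.mem_biUnion hv ⟨a, rfl, apply_zero_ne_of_mem_lineGeodesic hg⟩

lemma exists_eq_pC1_delta_of_memC1 (hmal : Malnormal B w) {f : Boundary B → Boundary B → ℤ}
    (hf : MemC1 B w f) :
    ∃ x : (Fin r × FreeGroup B) →₀ ℤ, ∀ ξ η, IsLine B w ξ η →
      f ξ η = pC1 B E.delta x ξ η := by
  obtain ⟨hanti, X, hX, -, -, hsupp, -⟩ := hf
  refine E.exists_eq_pC1_delta hmal hanti (E.finite_lineClass_passesThrough hX) fun a ha => ?_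
  refine ⟨a, rfl, ?_⟩
  by_contra h
  exact ha (hsupp _ _ (E.isLine_posEnd_negEnd a) h)

/-- The line with endpoints `w j ^ ±∞` is isolated: no other line has endpoints agreeing with
its endpoints to sufficiently high order. -/
lemma exists_isolating (j : Fin r) :
    ∃ M, (∃ d ≤ M, (E.pos j).1 d ≠ (E.neg j).1 d) ∧ ∀ ξ η, IsLine B w ξ η →
      initialWord ξ (M + 1) = initialWord (E.pos j) (M + 1) →
      initialWord η (M + 1) = initialWord (E.neg j) (M + 1) →
      ξ = E.pos j ∧ η = E.neg j := by
  obtain ⟨d, hd⟩ : ∃ d, (E.pos j).1 d ≠ (E.neg j).1 d := by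
    by_contra! h
    exact E.pos_ne_neg j (Subtype.ext (funext h))
  set v := prefixOf B (E.pos j) d with hv
  have hfin : {p : Boundary B × Boundary B | IsLine B w p.1 p.2 ∧
      PassesThrough B p.1 p.2 {v}}.Finite := by
    have hq := E.finite_lineClass_through v
    refine ((hq.image fun q => (E.posEnd q.out, E.negEnd q.out)).union
      (hq.image fun q => (E.negEnd q.out, E.posEnd q.out))).subset ?_
    rintro ⟨ξ, η⟩ ⟨hl, u, rfl, hg⟩
    have hne := apply_zero_ne_of_mem_lineGeodesic hg
    obtain ⟨a, ⟨rfl, rfl⟩ | ⟨rfl, rfl⟩⟩ := E.isLine_iff.1 hl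
    · refine Or.inl ⟨_, ⟨a, rfl, hne⟩, ?_⟩
      dsimp only
      rw [E.posEnd_eq_of_lineClass_eq (lineClass_out _),
        E.negEnd_eq_of_lineClass_eq (lineClass_out _)]
    · refine Or.inr ⟨_, ⟨a, rfl, hne.symm⟩, ?_⟩
      dsimp only
      rw [E.posEnd_eq_of_lineClass_eq (lineClass_out _),
        E.negEnd_eq_of_lineClass_eq (lineClass_out _)]
  have hsep : ∀ p : Boundary B × Boundary B, ∃ m, p ≠ (E.pos j, E.neg j) →
      ¬(initialWord p.1 m = initialWord (E.pos j) m ∧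
        initialWord p.2 m = initialWord (E.neg j) m) := by
    rintro ⟨ξ, η⟩
    by_contra! h
    obtain ⟨hne, -⟩ := h 0
    refine hne (Prod.ext (Subtype.ext (funext fun i => ?_)) (Subtype.ext (funext fun i => ?_)))
    · exact (initialWord_eq_iff _ _ (i + 1)).1 (h (i + 1)).2.1 i (by omega)
    · exact (initialWord_eq_iff _ _ (i + 1)).1 (h (i + 1)).2.2 i (by omega)
  choose m hm using hsep
  obtain ⟨M, hM⟩ := (hfin.image m).bddAbove
  refine ⟨max d M, ⟨d, le_max_left _ _, hd⟩, fun ξ η hl hξ hη => ?_⟩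
  have hdle : d ≤ max d M := le_max_left _ _
  rw [initialWord_eq_iff] at hξ hη
  have hpass : PassesThrough B ξ η {v} := by
    refine ⟨v, rfl, d, Or.inl ?_, d, le_rfl, ?_⟩
    · rw [hv, prefixOf_eq, prefixOf_eq, (initialWord_eq_iff ξ (E.pos j) d).2]
      exact fun i hi => hξ i (by omega)
    · rw [hξ d (by omega), hη d (by omega)]
      exact hd
  have hle : m (ξ, η) ≤ max d M :=
    (hM ⟨(ξ, η), ⟨hl, hpass⟩, rfl⟩).trans (le_max_right _ _)
  by_contra hne
  refine hm (ξ, η) (by simpa [Prod.ext_iff] using hne)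
    ⟨(initialWord_eq_iff _ _ _).2 fun i hi => hξ i (by omega),
      (initialWord_eq_iff _ _ _).2 fun i hi => hη i (by omega)⟩

lemma isLine_symm {ξ η : Boundary B} (h : IsLine B w ξ η) : IsLine B w η ξ := by
  obtain ⟨g, i, h⟩ := h
  exact ⟨g, i, h.symm⟩

lemma memC1_delta [Finite B] (j : Fin r) : MemC1 B w (E.delta j) := by
  classical
  obtain ⟨M, ⟨d, hdM, hd⟩, hiso⟩ := E.exists_isolating j
  refine ⟨fun ξ η _ => E.delta_swap j ξ η, ball B M, finite_ball M, ⟨1, one_mem_ball M⟩,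
    isSubtree_ball M, ?_, ?_⟩
  · intro ξ η hl hpass
    have hmem : prefixOf B (E.pos j) d ∈ ball B M := by simpa [ball] using hdM
    rw [delta, if_neg, if_neg, sub_zero]
    · rintro ⟨rfl, rfl⟩
      exact hpass ⟨_, hmem, d, Or.inr rfl, d, le_rfl, hd.symm⟩
    · rintro ⟨rfl, rfl⟩
      exact hpass ⟨_, hmem, d, Or.inl rfl, d, le_rfl, hd⟩
  · intro C C' hC hC' _ ξ ξ' η η' hl hl' hξ hξ' hη hη'
    have eξ := initialWord_eq_of_mem_boundaryOf hC hξ hξ'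
    have eη := initialWord_eq_of_mem_boundaryOf hC' hη hη'
    simp only [delta]
    congr 1
    · refine if_congr ⟨?_, ?_⟩ rfl rfl
      · rintro ⟨rfl, rfl⟩
        exact hiso _ _ hl' eξ.symm eη.symm
      · rintro ⟨rfl, rfl⟩
        exact hiso _ _ hl eξ eη
    · refine if_congr ⟨?_, ?_⟩ rfl rfl
      · rintro ⟨rfl, rfl⟩
        exact (hiso _ _ (isLine_symm hl') eη.symm eξ.symm).symm
      · rintro ⟨rfl, rfl⟩
        exact (hiso _ _ (isLine_symm hl) eη eξ).symm

end PatternEnds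

end Cochains

section FreeModule

variable {B : Type} [DecidableEq B] {k : ℕ}

lemma pC1_eq_linearCombination (f : Fin k → Boundary B → Boundary B → ℤ)
    (x : (Fin k × FreeGroup B) →₀ ℤ) (ξ η : Boundary B) :
    pC1 B f x ξ η =
      Finsupp.linearCombination ℤ (fun p => f p.1 (actB B p.2 ξ) (actB B p.2 η)) x := by
  simp [pC1, Finsupp.linearCombination_apply]

lemma fsTranslate_eq_lmapDomain (y : (Fin k × FreeGroup B) →₀ ℤ) (g : FreeGroup B) :
    fsTranslate B y g = Finsupp.lmapDomain ℤ ℤ (fun p => (p.1, p.2 * g)) y := rfl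

lemma pC1_fsTranslate (f : Fin k → Boundary B → Boundary B → ℤ)
    (x : (Fin k × FreeGroup B) →₀ ℤ) (g : FreeGroup B) (ξ η : Boundary B) :
    pC1 B f (fsTranslate B x g) ξ η = pC1 B f x (actB B g ξ) (actB B g η) := by
  simp only [pC1_eq_linearCombination, fsTranslate, Finsupp.linearCombination_mapDomain]
  congr 2
  funext p
  simp [actB_mul]

lemma fsTranslate_fsTranslate (y : (Fin k × FreeGroup B) →₀ ℤ) (g h : FreeGroup B) :
    fsTranslate B (fsTranslate B y g) h = fsTranslate B y (g * h) := by
  rw [fsTranslate, fsTranslate, ← Finsupp.mapDomain_comp, fsTranslate]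
  congr 1
  funext p
  simp [mul_assoc]

/-- The right `ℤ[F]`-submodule of the free module generated by a family, as an additive group. -/
noncomputable def translateSpan {ι : Type} (y : ι → (Fin k × FreeGroup B) →₀ ℤ) :
    Submodule ℤ ((Fin k × FreeGroup B) →₀ ℤ) :=
  Submodule.span ℤ (Set.range fun p : ι × FreeGroup B => fsTranslate B (y p.1) p.2)

lemma fsTranslate_generator_mem {ι : Type} (y : ι → (Fin k × FreeGroup B) →₀ ℤ) (i : ι)
    (g : FreeGroup B) : fsTranslate B (y i) g ∈ translateSpan y :=
  Submodule.subset_span ⟨(i, g), rfl⟩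

lemma fsTranslate_mem {ι : Type} {y : ι → (Fin k × FreeGroup B) →₀ ℤ}
    {z : (Fin k × FreeGroup B) →₀ ℤ} (hz : z ∈ translateSpan y) (g : FreeGroup B) :
    fsTranslate B z g ∈ translateSpan y := by
  rw [fsTranslate_eq_lmapDomain, ← Submodule.mem_comap]
  refine Submodule.span_le.2 ?_ hz
  rintro _ ⟨⟨i, h⟩, rfl⟩
  rw [SetLike.mem_coe, Submodule.mem_comap, ← fsTranslate_eq_lmapDomain, fsTranslate_fsTranslate]
  exact fsTranslate_generator_mem y i (h * g)

lemma exists_sum_of_mem_translateSpan {ι : Type} {y : ι → (Fin k × FreeGroup B) →₀ ℤ}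
    {z : (Fin k × FreeGroup B) →₀ ℤ} (hz : z ∈ translateSpan y) :
    ∃ (l : ℕ) (c : Fin l → ℤ) (j : Fin l → ι) (g : Fin l → FreeGroup B),
      z = ∑ i, c i • fsTranslate B (y (j i)) (g i) := by
  obtain ⟨c, rfl⟩ := Finsupp.mem_span_range_iff_exists_finsupp.1 hz
  let e := c.support.equivFin
  refine ⟨c.support.card, fun i => c (e.symm i), fun i => (e.symm i).1.1,
    fun i => (e.symm i).1.2, ?_⟩
  rw [Finsupp.sum, ← Finset.sum_coe_sort]
  exact (Equiv.sum_comp e.symm _).symm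

end FreeModule

section Cylinders

variable {B : Type} [DecidableEq B]

/-- The indicator function of the set of boundary points with initial segment `L`. -/
def cylinderIndicator (L : List (B × Bool)) (ξ : Boundary B) : ℤ :=
  if initialWord ξ L.length = L then 1 else 0

lemma initialWord_eq_cons_iff (ξ : Boundary B) (x : B × Bool) (L : List (B × Bool)) :
    initialWord ξ (L.length + 1) = x :: L ↔
      ξ.1 0 = x ∧ initialWord (consB B (invLetter x) ξ) L.length = L := by
  constructor
  · intro h
    have h0 : ξ.1 0 = x := by
      have := congrArg (fun L => L[0]?) h
      simpa using this
    refine ⟨h0, ?_⟩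
    rw [initialWord_succ_of_eq (x := invLetter x) (by simpa using h0)] at h
    exact (List.cons.inj h).2
  · rintro ⟨h0, h⟩
    rw [initialWord_succ_of_eq (x := invLetter x) (by simpa using h0), h, invLetter_invLetter]

lemma continuous_cylinderIndicator_singleton (x : B × Bool) :
    Continuous (cylinderIndicator [x]) := by
  have : DiscreteTopology (B × Bool) := ⟨rfl⟩
  have h : cylinderIndicator [x] =
      (fun y : B × Bool => if y = x then (1 : ℤ) else 0) ∘ fun ξ : Boundary B => ξ.1 0 := by
    funext ξ
    simp [cylinderIndicator, initialWord]
  rw [h]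
  exact continuous_of_discreteTopology.comp ((continuous_apply 0).comp continuous_subtype_val)

lemma cylinderIndicator_cons_cons_invLetter (x : B × Bool) (L : List (B × Bool)) :
    cylinderIndicator (x :: invLetter x :: L) = 0 := by
  funext ξ
  refine if_neg fun h => ?_
  have h0 := congrArg (fun L => L[0]?) h
  have h1 := congrArg (fun L => L[1]?) h
  simp at h0 h1
  exact ξ.2 0 (by rw [zero_add, h1, h0]; rfl)

lemma cylinderIndicator_cons_cons {x y : B × Bool} (hxy : y ≠ invLetter x)
    (L : List (B × Bool)) (ξ : Boundary B) :
    cylinderIndicator (x :: y :: L) ξ =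
      cylinderIndicator (y :: L) (actB B (FreeGroup.mk [invLetter x]) ξ) := by
  refine if_congr ?_ rfl rfl
  rw [List.length_cons, initialWord_eq_cons_iff, actB_letter, and_iff_right_iff_imp]
  intro h
  by_contra hne
  rw [List.length_cons, initialWord_consB_of_ne (by simpa using hne)] at h
  exact hxy (List.cons.inj h).1.symm

/-- A translation-invariant group of functions containing the indicators of one-letter cylinders
contains the indicators of all cylinders. -/
lemma cylinderIndicator_mem {R : Submodule ℤ (Boundary B → ℤ)}
    (htrans : ∀ σ ∈ R, ∀ g, (fun ξ => σ (actB B g ξ)) ∈ R)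
    (hletter : ∀ x, cylinderIndicator [x] ∈ R) (L : List (B × Bool)) (x : B × Bool) :
    cylinderIndicator (x :: L) ∈ R := by
  induction L generalizing x with
  | nil => exact hletter x
  | cons y L ih =>
    by_cases hxy : y = invLetter x
    · rw [hxy, cylinderIndicator_cons_cons_invLetter]
      exact R.zero_mem
    · rw [funext (cylinderIndicator_cons_cons hxy L)]
      exact htrans _ (ih y) _

instance [Finite B] : CompactSpace (Boundary B) := by
  have : DiscreteTopology (B × Bool) := ⟨rfl⟩
  refine isCompact_iff_compactSpace.1 (IsClosed.isCompact ?_)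
  change IsClosed {s : ℕ → B × Bool | ∀ k, s (k + 1) ≠ ((s k).1, !(s k).2)}
  rw [Set.ofPred_forall]
  refine isClosed_iInter fun k => ?_
  have hcont : Continuous fun s : ℕ → B × Bool => (s (k + 1), s k) := by fun_prop
  exact (isClosed_discrete {p : (B × Bool) × (B × Bool) | p.1 ≠ (p.2.1, !p.2.2)}).preimage hcont

lemma isOpen_initialWord_eq (ξ : Boundary B) (m : ℕ) :
    IsOpen {η : Boundary B | initialWord η m = initialWord ξ m} := by
  have : DiscreteTopology (B × Bool) := ⟨rfl⟩
  have : {η : Boundary B | initialWord η m = initialWord ξ m} =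
      ⋂ i ∈ Finset.range m, (fun η : Boundary B => η.1 i) ⁻¹' {ξ.1 i} := by
    ext η
    simp [initialWord_eq_iff]
  rw [this]
  exact isOpen_biInter_finset fun i _ =>
    (isOpen_discrete _).preimage ((continuous_apply i).comp continuous_subtype_val)

/-- Every neighbourhood of a boundary point contains a cylinder about it. -/
lemma exists_initialWord_subset {U : Set (Boundary B)} (hU : IsOpen U) {ξ : Boundary B}
    (hξ : ξ ∈ U) : ∃ m, ∀ η, initialWord η m = initialWord ξ m → η ∈ U := by
  obtain ⟨V, hV, rfl⟩ := isOpen_induced_iff.1 hU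
  obtain ⟨I, u, hu, hsub⟩ := isOpen_pi_iff.1 hV ξ.1 hξ
  refine ⟨I.sup id + 1, fun η hη => hsub fun i hi => ?_⟩
  rw [(initialWord_eq_iff _ _ _).1 hη i (Nat.lt_succ_of_le (Finset.le_sup (f := id) hi))]
  exact (hu i hi).2

/-- A continuous integer-valued function on the boundary depends on finitely many letters. -/
lemma exists_eq_of_initialWord_eq [Finite B] {σ : Boundary B → ℤ} (hσ : Continuous σ) :
    ∃ m, ∀ ξ η, initialWord ξ m = initialWord η m → σ ξ = σ η := by
  have hloc : ∀ ξ, ∃ m, ∀ η, initialWord η m = initialWord ξ m → σ η = σ ξ := fun ξ =>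
    exists_initialWord_subset ((isOpen_discrete {σ ξ}).preimage hσ) rfl
  choose m hm using hloc
  obtain ⟨t, ht⟩ := isCompact_univ.elim_finite_subcover
    (fun ξ => {η : Boundary B | initialWord η (m ξ) = initialWord ξ (m ξ)})
    (fun ξ => isOpen_initialWord_eq ξ _) (fun ξ _ => Set.mem_iUnion.2 ⟨ξ, rfl⟩)
  refine ⟨t.sup m, fun ξ η h => ?_⟩
  obtain ⟨ζ, hζ, hξ⟩ := Set.mem_iUnion₂.1 (ht (Set.mem_univ ξ))
  have hη : initialWord η (m ζ) = initialWord ζ (m ζ) := by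
    rw [← show initialWord ξ (m ζ) = _ from hξ, initialWord_eq_iff]
    rw [initialWord_eq_iff] at h
    exact fun i hi => (h i (hi.trans_le (Finset.le_sup hζ))).symm
  rw [hm ζ ξ hξ, hm ζ η hη]

/-- A translation-invariant group of functions containing the indicators of one-letter cylinders
contains all continuous functions. -/
lemma continuous_mem [Finite B] {R : Submodule ℤ (Boundary B → ℤ)}
    (htrans : ∀ σ ∈ R, ∀ g, (fun ξ => σ (actB B g ξ)) ∈ R)
    (hletter : ∀ x, cylinderIndicator [x] ∈ R) {σ : Boundary B → ℤ} (hσ : Continuous σ) :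
    σ ∈ R := by
  classical
  obtain ⟨m, hm⟩ := exists_eq_of_initialWord_eq hσ
  replace hm : ∀ ξ η, initialWord ξ (m + 1) = initialWord η (m + 1) → σ ξ = σ η := by
    intro ξ η h
    refine hm ξ η ((initialWord_eq_iff _ _ _).2 fun i hi => ?_)
    exact (initialWord_eq_iff _ _ _).1 h i (by omega)
  have := Fintype.ofFinite B
  let word : Boundary B → Fin (m + 1) → B × Bool := fun ξ i => ξ.1 i
  have hword : ∀ ξ p, cylinderIndicator (List.ofFn p) ξ = if word ξ = p then 1 else 0 := by
    intro ξ p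
    refine if_congr ?_ rfl rfl
    rw [List.length_ofFn, initialWord, List.ofFn_inj]
  have hsum : σ = ∑ p : Fin (m + 1) → B × Bool,
      (if h : ∃ ξ, word ξ = p then σ h.choose else 0) • cylinderIndicator (List.ofFn p) := by
    funext ξ
    have h : ∃ η, word η = word ξ := ⟨ξ, rfl⟩
    rw [Finset.sum_apply, Finset.sum_eq_single (word ξ)]
    · rw [Pi.smul_apply, hword, if_pos rfl, dif_pos h, smul_eq_mul, mul_one]
      exact hm _ _ (congrArg List.ofFn h.choose_spec).symm
    · intro p _ hp
      rw [Pi.smul_apply, hword, if_neg hp.symm, smul_zero]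
    · simp
  rw [hsum]
  refine R.sum_mem fun p _ => R.smul_mem _ ?_
  rw [List.ofFn_succ]
  exact cylinderIndicator_mem htrans hletter _ _

end Cylinders

section Presentation

variable {B : Type} [DecidableEq B] {r : ℕ} {w : Fin r → FreeGroup B}

/-- The relation expressing that the line with endpoints `w i ^ ±∞` is fixed by `w i`. -/
noncomputable def stabilizerRelation (w : Fin r → FreeGroup B) (i : Fin r) :
    (Fin r × FreeGroup B) →₀ ℤ :=
  Finsupp.single (i, w i) 1 - Finsupp.single (i, 1) 1

lemma fsTranslate_stabilizerRelation (i : Fin r) (g : FreeGroup B) :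
    fsTranslate B (stabilizerRelation w i) g =
      Finsupp.single (i, w i * g) 1 - Finsupp.single (i, g) 1 := by
  rw [fsTranslate_eq_lmapDomain, stabilizerRelation, map_sub]
  simp

lemma lineClass_mul (i : Fin r) (g : FreeGroup B) :
    lineClass w (i, w i * g) = lineClass w (i, g) := by
  rw [lineClass_eq_iff]
  exact ⟨rfl, by simp⟩

lemma single_sub_single_mem {N : Submodule ℤ ((Fin r × FreeGroup B) →₀ ℤ)}
    (hN : ∀ i g, fsTranslate B (stabilizerRelation w i) g ∈ N) {a b : Fin r × FreeGroup B}
    (hab : lineClass w a = lineClass w b) :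
    Finsupp.single a 1 - Finsupp.single b 1 ∈ N := by
  obtain ⟨i, g⟩ := a
  obtain ⟨j, h⟩ := b
  obtain ⟨rfl, n, hn⟩ := lineClass_eq_iff.1 hab
  obtain rfl : h = w i ^ n * g := by
    rw [show w i ^ n = h * g⁻¹ from hn, inv_mul_cancel_right]
  have key : ∀ n : ℤ, (Finsupp.single (i, g) (1 : ℤ) : (Fin r × FreeGroup B) →₀ ℤ) -
      Finsupp.single (i, w i ^ n * g) 1 ∈ N := by
    intro n
    have step : ∀ n : ℤ, (Finsupp.single (i, w i ^ (n + 1) * g) (1 : ℤ) :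
        (Fin r × FreeGroup B) →₀ ℤ) - Finsupp.single (i, w i ^ n * g) 1 ∈ N := by
      intro n
      have := hN i (w i ^ n * g)
      rwa [fsTranslate_stabilizerRelation, ← mul_assoc, ← zpow_one_add, add_comm] at this
    induction n with
    | zero => simp
    | succ n ih => simpa using N.sub_mem ih (step n)
    | pred n ih => simpa using N.add_mem ih (step (-n - 1))
  exact key n

/-- Elements of the free module inducing the zero cochain are combinations of the stabilizer
relations. -/
lemma mem_of_mapDomain_lineClass_eq_zero {N : Submodule ℤ ((Fin r × FreeGroup B) →₀ ℤ)}
    (hN : ∀ i g, fsTranslate B (stabilizerRelation w i) g ∈ N)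
    {x : (Fin r × FreeGroup B) →₀ ℤ} (hx : x.mapDomain (lineClass w) = 0) : x ∈ N := by
  have hsub : ∀ x : (Fin r × FreeGroup B) →₀ ℤ,
      x - (x.mapDomain (lineClass w)).mapDomain Quotient.out ∈ N := by
    intro x
    induction x using Finsupp.induction_linear with
    | zero => simp
    | add x y hx hy =>
      rw [Finsupp.mapDomain_add, Finsupp.mapDomain_add, add_sub_add_comm]
      exact N.add_mem hx hy
    | single a c =>
      rw [Finsupp.mapDomain_single, Finsupp.mapDomain_single]
      have := N.smul_mem c (single_sub_single_mem hN (lineClass_out (lineClass w a)).symm)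
      simpa [smul_sub] using this
  simpa [hx] using hsub x

namespace PatternEnds

variable (E : PatternEnds w)

lemma mapDomain_eq_zero (hmal : Malnormal B w) {x : (Fin r × FreeGroup B) →₀ ℤ}
    (hx : ∀ ξ η, IsLine B w ξ η → pC1 B E.delta x ξ η = 0) : x.mapDomain (lineClass w) = 0 := by
  ext q
  rw [← lineClass_out q, ← E.pC1_posEnd_negEnd hmal, hx _ _ (E.isLine_posEnd_negEnd _)]
  rfl

lemma pC1_stabilizerRelation (hmal : Malnormal B w) (i : Fin r) {ξ η : Boundary B}
    (hl : IsLine B w ξ η) : pC1 B E.delta (stabilizerRelation w i) ξ η = 0 := by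
  refine E.eq_on_lines (f' := fun _ _ => 0) (E.antisym_pC1_delta _) (fun _ _ _ => neg_zero.symm)
    (fun a => ?_) hl
  have h : lineClass w (i, w i) = lineClass w (i, 1) := by simpa using lineClass_mul i 1
  rw [E.pC1_posEnd_negEnd hmal, stabilizerRelation, Finsupp.mapDomain_sub]
  simp [h]

/-- The coboundary of the indicator of a one-letter cylinder is induced by an element of the free
module. -/
lemma exists_letterRelation (hmal : Malnormal B w) (x : B × Bool) :
    ∃ y : (Fin r × FreeGroup B) →₀ ℤ, ∀ ξ η, IsLine B w ξ η →
      pC1 B E.delta y ξ η = cylinderIndicator [x] η - cylinderIndicator [x] ξ := by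
  obtain ⟨y, hy⟩ := E.exists_eq_pC1_delta hmal
    (f := fun ξ η => cylinderIndicator [x] η - cylinderIndicator [x] ξ)
    (fun ξ η _ => (neg_sub _ _).symm) (E.finite_lineClass_through 1) fun a ha => ⟨a, rfl, by
      contrapose! ha
      rw [inv_one, actB_one, actB_one] at ha
      simp [cylinderIndicator, initialWord, ha]⟩
  exact ⟨y, fun ξ η hl => (hy ξ η hl).symm⟩

/-- The functions whose coboundary is induced by an element of `N`. -/
def realizable (E : PatternEnds w) (N : Submodule ℤ ((Fin r × FreeGroup B) →₀ ℤ)) :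
    Submodule ℤ (Boundary B → ℤ) where
  carrier := {σ | ∃ z ∈ N, ∀ ξ η, IsLine B w ξ η → pC1 B E.delta z ξ η = σ η - σ ξ}
  zero_mem' := ⟨0, N.zero_mem, fun ξ η _ => by simp [pC1]⟩
  add_mem' := by
    rintro σ τ ⟨z, hz, hσ⟩ ⟨y, hy, hτ⟩
    refine ⟨z + y, N.add_mem hz hy, fun ξ η hl => ?_⟩
    have h1 := hσ ξ η hl
    have h2 := hτ ξ η hl
    rw [pC1_eq_linearCombination] at h1 h2 ⊢
    rw [map_add, h1, h2, Pi.add_apply, Pi.add_apply, add_sub_add_comm]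
  smul_mem' := by
    rintro c σ ⟨z, hz, hσ⟩
    refine ⟨c • z, N.smul_mem c hz, fun ξ η hl => ?_⟩
    have h1 := hσ ξ η hl
    rw [pC1_eq_linearCombination] at h1 ⊢
    rw [map_smul, h1, Pi.smul_apply, Pi.smul_apply, smul_sub]

lemma translate_mem_realizable {ι : Type} {y : ι → (Fin r × FreeGroup B) →₀ ℤ}
    {σ : Boundary B → ℤ} (hσ : σ ∈ E.realizable (translateSpan y)) (g : FreeGroup B) :
    (fun ξ => σ (actB B g ξ)) ∈ E.realizable (translateSpan y) := by
  obtain ⟨z, hz, h⟩ := hσ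
  refine ⟨fsTranslate B z g, fsTranslate_mem hz g, fun ξ η hl => ?_⟩
  rw [pC1_fsTranslate, h _ _ (E.isLine_actB hl g)]

/-- The stabilizer and letter relations generate the preimage of the coboundaries. -/
lemma mem_translateSpan [Finite B] (hmal : Malnormal B w) {ι : Type}
    {y : ι → (Fin r × FreeGroup B) →₀ ℤ} (hstab : ∀ i, ∃ t, y t = stabilizerRelation w i)
    (hletter : ∀ x, ∃ t, ∀ ξ η, IsLine B w ξ η →
      pC1 B E.delta (y t) ξ η = cylinderIndicator [x] η - cylinderIndicator [x] ξ)
    {x : (Fin r × FreeGroup B) →₀ ℤ} {σ : Boundary B → ℤ} (hσ : Continuous σ)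
    (hx : ∀ ξ η, IsLine B w ξ η → pC1 B E.delta x ξ η = σ η - σ ξ) : x ∈ translateSpan y := by
  have hmem : σ ∈ E.realizable (translateSpan y) := by
    refine continuous_mem (fun τ hτ g => E.translate_mem_realizable hτ g) (fun a => ?_) hσ
    obtain ⟨t, ht⟩ := hletter a
    refine ⟨fsTranslate B (y t) 1, fsTranslate_generator_mem y t 1, fun ξ η hl => ?_⟩
    rw [pC1_fsTranslate, actB_one, actB_one, ht ξ η hl]
  obtain ⟨z, hz, hzσ⟩ := hmem
  have hdiff : x - z ∈ translateSpan y := by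
    refine mem_of_mapDomain_lineClass_eq_zero (w := w) (fun i g => ?_)
      (E.mapDomain_eq_zero hmal fun ξ η hl => ?_)
    · obtain ⟨t, ht⟩ := hstab i
      exact ht ▸ fsTranslate_generator_mem y t g
    · have h1 := hx ξ η hl
      have h2 := hzσ ξ η hl
      rw [pC1_eq_linearCombination] at h1 h2 ⊢
      rw [map_sub, h1, h2, sub_self]
  simpa using (translateSpan y).add_mem hdiff hz

end PatternEnds

end Presentation

end DecompPaper

open DecompPaper
/-- the right `ℤ[F]`-module `C¹ / B¹` (which computes the first Čech
cohomology of `D`) is finitely presented: there are finitely many elements `F j` of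
`C¹` whose classes generate the quotient, and the preimage of `B¹` under the induced
map `p : (ℤ[F])^k → C¹` is finitely generated as a `ℤ[F]`-module.  (Equalities between
elements of `C¹` are evaluated on oriented lines.) -/
theorem first_cohomology_finitely_presented
    (B : Type) [Fintype B] [DecidableEq B] (hB : 2 ≤ Fintype.card B)
    (r : ℕ) (w : Fin r → FreeGroup B) (hw : ∀ i, w i ≠ 1) (hmal : Malnormal B w) :
    ∃ (k : ℕ) (F : Fin k → Boundary B → Boundary B → ℤ),
      (∀ j, MemC1 B w (F j)) ∧
      (∀ f : Boundary B → Boundary B → ℤ, MemC1 B w f →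
        ∃ (x : (Fin k × FreeGroup B) →₀ ℤ) (σ : Boundary B → ℤ),
          Continuous σ ∧
          ∀ ξ η, IsLine B w ξ η → f ξ η = pC1 B F x ξ η + (σ η - σ ξ)) ∧
      ∃ (m : ℕ) (y : Fin m → (Fin k × FreeGroup B) →₀ ℤ),
        (∀ i, ∃ σ : Boundary B → ℤ, Continuous σ ∧
          ∀ ξ η, IsLine B w ξ η → pC1 B F (y i) ξ η = σ η - σ ξ) ∧
        ∀ x : (Fin k × FreeGroup B) →₀ ℤ,
          (∃ σ : Boundary B → ℤ, Continuous σ ∧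
            ∀ ξ η, IsLine B w ξ η → pC1 B F x ξ η = σ η - σ ξ) →
          ∃ (l : ℕ) (c : Fin l → ℤ) (j : Fin l → Fin m) (g : Fin l → FreeGroup B),
            x = ∑ i, c i • fsTranslate B (y (j i)) (g i) := by
  obtain ⟨E⟩ := nonempty_patternEnds hw
  choose u hu using E.exists_letterRelation hmal
  obtain ⟨m, ⟨e⟩⟩ := Finite.exists_equiv_fin (Fin r ⊕ B × Bool)
  let y : Fin r ⊕ B × Bool → (Fin r × FreeGroup B) →₀ ℤ := Sum.elim (stabilizerRelation w) u
  refine ⟨r, E.delta, E.memC1_delta, fun f hf => ?_, m, fun t => y (e.symm t), fun t => ?_, ?_⟩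
  · obtain ⟨x, hx⟩ := E.exists_eq_pC1_delta_of_memC1 hmal hf
    exact ⟨x, 0, continuous_const, by simpa using hx⟩
  · rcases h : e.symm t with i | a
    · exact ⟨0, continuous_const, fun ξ η hl => by
        simpa [y, h] using E.pC1_stabilizerRelation hmal i hl⟩
    · exact ⟨cylinderIndicator [a], continuous_cylinderIndicator_singleton a, fun ξ η hl => by
        simpa [y, h] using hu a ξ η hl⟩
  · rintro x ⟨σ, hσ, hx⟩
    have hmem : x ∈ translateSpan fun t => y (e.symm t) := by
      refine E.mem_translateSpan hmal (fun i => ⟨e (Sum.inl i), ?_⟩)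
        (fun a => ⟨e (Sum.inr a), ?_⟩) hσ hx
      · simp [y]
      · simpa [y] using hu a
    obtain ⟨l, c, j, g, h⟩ := exists_sum_of_mem_translateSpan hmem
    exact ⟨l, c, j, g, h⟩
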